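/- arXiv:1604.07196 — 2 statements merged into one kernel-verified Lean document; each statement's English description precedes it below -/
import Mathlib

section
/- Let K ≥ 2, N ≥ 2, F_s > 0, and for k = 1,…,K let z_k = e^{−d_k} e^{2πi f_k/F_s} with d_k ≥ 0 and f_k ∈ [0, F_s) pairwise distinct. Set d_max = max_{1≤k≤K} d_k and let δ be the minimum wrap-around distance between the frequencies f_k. If d_max < 1/(N−1) and δ > 84 F_s / (π (N−1)(1 − d_max(N−1))), then the largest singular value of the Vandermonde matrix V_N ∈ ℂ^{N×K} satisfies σ_max²(V_N) ≤ N − 1 + 84 F_s/(π δ); equivalently, for every u ∈ ℂ^K, ‖V_N u‖₂² ≤ [ N − 1 + 84 F_s/(π δ) ] ‖u‖₂². -/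
open scoped BigOperators

/-- Euclidean (ℓ²) norm of a complex vector. -/
noncomputable def enorm2 {n : ℕ} (v : Fin n → ℂ) : ℝ := Real.sqrt (∑ i, ‖v i‖ ^ 2)

/-- Vandermonde matrix with nodes `z`, `L` rows: entry `(n, k)` is `z k ^ n`. -/
def vand {K : ℕ} (z : Fin K → ℂ) (L : ℕ) : Matrix (Fin L) (Fin K) ℂ :=
  Matrix.of fun n k => z k ^ (n : ℕ)

lemma sum_inv_sq_le_two_of_one_le {ι : Type*} (s : Finset ι) (y : ι → ℝ)
    (h1 : ∀ i ∈ s, 1 ≤ y i) (hsep : ∀ i ∈ s, ∀ j ∈ s, i ≠ j → 1 ≤ |y i - y j|) :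
    ∑ i ∈ s, 1 / y i ^ 2 ≤ 2 := by
  classical
  have hinj : Set.InjOn (fun i => ⌊y i⌋₊) s := by
    intro i hi j hj hij
    by_contra hne
    have hi0 := h1 i hi
    have hj0 := h1 j hj
    have h := hsep i hi j hj hne
    have a1 := Nat.floor_le (show 0 ≤ y i by linarith)
    have a2 := Nat.lt_floor_add_one (y i)
    have b1 := Nat.floor_le (show 0 ≤ y j by linarith)
    have b2 := Nat.lt_floor_add_one (y j)
    simp only at hij
    rw [hij] at a1 a2
    have : |y i - y j| < 1 := abs_lt.2 ⟨by linarith, by linarith⟩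
    linarith
  have hfl : ∀ i ∈ s, 1 ≤ ⌊y i⌋₊ := fun i hi => Nat.le_floor (by simpa using h1 i hi)
  calc ∑ i ∈ s, 1 / y i ^ 2 ≤ ∑ i ∈ s, (((⌊y i⌋₊ : ℕ) : ℝ) ^ 2)⁻¹ := by
        refine Finset.sum_le_sum fun i hi => ?_
        rw [one_div]
        have h0 : (1 : ℝ) ≤ (⌊y i⌋₊ : ℝ) := by exact_mod_cast hfl i hi
        have := Nat.floor_le (show 0 ≤ y i by linarith [h1 i hi])
        gcongr
    _ = ∑ n ∈ s.image fun i => ⌊y i⌋₊, ((n : ℝ) ^ 2)⁻¹ := by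
        rw [Finset.sum_image hinj]
    _ ≤ ∑ n ∈ Finset.Ioo 0 ((s.image fun i => ⌊y i⌋₊).sup id + 1), ((n : ℝ) ^ 2)⁻¹ := by
        refine Finset.sum_le_sum_of_subset_of_nonneg (fun n hn => ?_) fun _ _ _ => by positivity
        have hle : n ≤ (s.image fun i => ⌊y i⌋₊).sup id := Finset.le_sup (f := id) hn
        obtain ⟨i, hi, rfl⟩ := Finset.mem_image.1 hn
        have := hfl i hi
        rw [Finset.mem_Ioo]
        omega
    _ ≤ 2 := by simpa using sum_Ioo_inv_sq_le (α := ℝ) 0 _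

lemma sum_inv_sq_le_four_of_one_le_abs {ι : Type*} (s : Finset ι) (y : ι → ℝ)
    (h1 : ∀ i ∈ s, 1 ≤ |y i|) (hsep : ∀ i ∈ s, ∀ j ∈ s, i ≠ j → 1 ≤ |y i - y j|) :
    ∑ i ∈ s, 1 / y i ^ 2 ≤ 4 := by
  classical
  rw [← Finset.sum_filter_add_sum_filter_not s (fun i => 0 ≤ y i)]
  have hp : ∑ i ∈ s with 0 ≤ y i, 1 / y i ^ 2 ≤ 2 := by
    refine sum_inv_sq_le_two_of_one_le _ _ (fun i hi => ?_) fun i hi j hj =>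
      hsep i (Finset.mem_filter.1 hi).1 j (Finset.mem_filter.1 hj).1
    obtain ⟨hi, h0⟩ := Finset.mem_filter.1 hi
    simpa [abs_of_nonneg h0] using h1 i hi
  have hn : ∑ i ∈ s with ¬ 0 ≤ y i, 1 / (-y i) ^ 2 ≤ 2 := by
    refine sum_inv_sq_le_two_of_one_le _ _ (fun i hi => ?_) fun i hi j hj hij => ?_
    · obtain ⟨hi, h0⟩ := Finset.mem_filter.1 hi
      simpa [abs_of_neg (not_le.1 h0)] using h1 i hi
    · rw [← abs_neg, show -(-y i - -y j) = y i - y j by ring]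
      exact hsep i (Finset.mem_filter.1 hi).1 j (Finset.mem_filter.1 hj).1 hij
  simp only [neg_sq] at hn
  linarith

lemma two_mul_abs_sub_round_le_norm_one_sub (r t : ℝ) (h0 : 0 ≤ r) (h1 : r ≤ 1) :
    2 * |t - round t| ≤ ‖1 - (r : ℂ) * Complex.exp (2 * Real.pi * Complex.I * t)‖ := by
  set e := Complex.exp (2 * Real.pi * Complex.I * t) with he
  have hper : e = Complex.exp (Complex.I * ((2 * Real.pi * (t - round t) : ℝ) : ℂ)) := by
    rw [he, ← Complex.exp_periodic.int_mul (round t)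
      (Complex.I * ((2 * Real.pi * (t - round t) : ℝ) : ℂ))]
    congr 1
    push_cast
    ring
  have hnorm : ‖e‖ = 1 := by
    rw [hper, mul_comm]
    exact Complex.norm_exp_ofReal_mul_I _
  have hchord : 4 * |t - round t| ≤ ‖1 - e‖ := by
    rw [norm_sub_rev, hper, Complex.norm_exp_I_mul_ofReal_sub_one, norm_mul, Real.norm_eq_abs,
      Real.norm_eq_abs, abs_of_pos (two_pos : (0 : ℝ) < 2)]
    have hr := abs_sub_round t
    have hx : |2 * Real.pi * (t - round t) / 2| = Real.pi * |t - round t| := by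
      rw [show 2 * Real.pi * (t - round t) / 2 = Real.pi * (t - round t) by ring, abs_mul,
        abs_of_pos Real.pi_pos]
    have := Real.mul_abs_le_abs_sin (x := 2 * Real.pi * (t - round t) / 2)
      (by rw [hx]; nlinarith [Real.pi_pos])
    rw [hx] at this
    have hpi : 2 / Real.pi * (Real.pi * |t - round t|) = 2 * |t - round t| := by
      field_simp
    linarith
  have htri : ‖1 - e‖ ≤ ‖1 - (r : ℂ) * e‖ + (1 - r) := by
    calc ‖1 - e‖ = ‖(1 - (r : ℂ) * e) + -(((1 - r : ℝ) : ℂ) * e)‖ := by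
          congr 1; push_cast; ring
      _ ≤ _ := by
          refine (norm_add_le _ _).trans (le_of_eq ?_)
          rw [norm_neg, norm_mul, hnorm, Complex.norm_real, Real.norm_of_nonneg (by linarith),
            mul_one]
  have hrev : 1 - r ≤ ‖1 - (r : ℂ) * e‖ := by
    have := norm_sub_norm_le (1 : ℂ) ((r : ℂ) * e)
    rw [norm_mul, hnorm, Complex.norm_real, Real.norm_of_nonneg h0, norm_one, mul_one] at this
    exact this
  linarith

lemma norm_geom_sum_mul_norm_one_sub_le {w : ℂ} (hw : ‖w‖ ≤ 1) (L : ℕ) :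
    ‖∑ n ∈ Finset.range L, w ^ n‖ * ‖1 - w‖ ≤ 2 := by
  rw [← norm_mul, geom_sum_mul_neg]
  calc ‖1 - w ^ L‖ ≤ ‖(1 : ℂ)‖ + ‖w ^ L‖ := norm_sub_le _ _
    _ ≤ 1 + 1 := by
      rw [norm_one, norm_pow]
      gcongr
      exact pow_le_one₀ (norm_nonneg _) hw
    _ = 2 := by norm_num

lemma sum_norm_sq_add_index_eq {ι : Type*} [Fintype ι] (v z : ι → ℂ) (A B : ℕ) :
    ((∑ j ∈ Finset.range A, ∑ i ∈ Finset.range B, ‖∑ k, v k * z k ^ (i + j)‖ ^ 2 : ℝ) : ℂ) =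
      ∑ k, ∑ l, v k * (starRingEnd ℂ) (v l) *
        ((∑ n ∈ Finset.range A, (z k * (starRingEnd ℂ) (z l)) ^ n) *
          ∑ n ∈ Finset.range B, (z k * (starRingEnd ℂ) (z l)) ^ n) := by
  have hsq : ∀ n : ℕ, ((‖∑ k, v k * z k ^ n‖ ^ 2 : ℝ) : ℂ) =
      ∑ k, ∑ l, v k * (starRingEnd ℂ) (v l) * (z k * (starRingEnd ℂ) (z l)) ^ n := by
    intro n
    push_cast
    rw [← Complex.mul_conj', map_sum, Finset.sum_mul_sum]
    refine Finset.sum_congr rfl fun k _ => Finset.sum_congr rfl fun l _ => ?_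
    rw [map_mul, map_pow, mul_pow]
    ring
  rw [Complex.ofReal_sum]
  simp_rw [Complex.ofReal_sum, hsq, Finset.sum_mul_sum, Finset.mul_sum]
  rw [Finset.sum_congr rfl fun j _ => Finset.sum_comm, Finset.sum_comm]
  refine Finset.sum_congr rfl fun k _ => ?_
  rw [Finset.sum_congr rfl fun j _ => Finset.sum_comm, Finset.sum_comm]
  refine Finset.sum_congr rfl fun l _ => Finset.sum_congr rfl fun j _ =>
    Finset.sum_congr rfl fun i _ => ?_
  rw [pow_add]
  ring

lemma sum_mul_mul_le_of_row_sum_le {ι : Type*} [Fintype ι] (a : ι → ℝ) (b : ι → ι → ℝ)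
    (hb : ∀ k l, 0 ≤ b k l) (hsymm : ∀ k l, b k l = b l k) (C : ℝ)
    (hC : ∀ k, ∑ l, b k l ≤ C) :
    ∑ k, ∑ l, a k * a l * b k l ≤ C * ∑ k, a k ^ 2 := by
  have hswap : ∑ k, ∑ l, a l ^ 2 * b k l = ∑ k, ∑ l, a k ^ 2 * b k l := by
    rw [Finset.sum_comm]
    simp_rw [hsymm]
  have hrow : ∑ k, ∑ l, a k ^ 2 * b k l ≤ C * ∑ k, a k ^ 2 := by
    rw [Finset.mul_sum]
    refine Finset.sum_le_sum fun k _ => ?_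
    rw [← Finset.mul_sum, mul_comm]
    exact mul_le_mul_of_nonneg_right (hC k) (sq_nonneg _)
  have hle : 2 * ∑ k, ∑ l, a k * a l * b k l ≤
      ∑ k, ∑ l, a k ^ 2 * b k l + ∑ k, ∑ l, a l ^ 2 * b k l := by
    simp_rw [Finset.mul_sum, ← Finset.sum_add_distrib]
    refine Finset.sum_le_sum fun k _ => Finset.sum_le_sum fun l _ => ?_
    nlinarith [mul_nonneg (sq_nonneg (a k - a l)) (hb k l)]
  linarith

lemma inv_pow_mul_geom_sum_le {q : ℝ} (h0 : 0 < q) (h1 : q ≤ 1) (M N : ℕ) :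
    (q ^ M)⁻¹ * ∑ n ∈ Finset.range (M + N), q ^ n ≤ N + M * (q ^ M)⁻¹ := by
  have hM : ∑ n ∈ Finset.range M, q ^ n ≤ M := by
    simpa using Finset.sum_le_card_nsmul (Finset.range M) (fun n => q ^ n) 1
      fun n _ => pow_le_one₀ h0.le h1
  have hN : ∑ n ∈ Finset.range N, q ^ n ≤ N := by
    simpa using Finset.sum_le_card_nsmul (Finset.range N) (fun n => q ^ n) 1
      fun n _ => pow_le_one₀ h0.le h1
  have hq : 0 < q ^ M := pow_pos h0 M
  rw [Finset.sum_range_add, mul_add]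
  simp_rw [pow_add]
  rw [← Finset.mul_sum, inv_mul_cancel_left₀ hq.ne', mul_comm, add_comm]
  gcongr

lemma mul_sum_range_le_sum_window (g : ℕ → ℝ) (hg : ∀ n, 0 ≤ g n) (M N : ℕ) :
    M * ∑ n ∈ Finset.range N, g (M + n) ≤
      ∑ j ∈ Finset.range M, ∑ i ∈ Finset.range (M + N), g (i + j) := by
  rw [← nsmul_eq_mul]
  nth_rw 1 [← Finset.card_range M]
  refine Finset.card_nsmul_le_sum _ _ _ fun j hj => ?_
  have hj := Finset.mem_range.1 hj
  calc ∑ n ∈ Finset.range N, g (M + n)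
      = ∑ i ∈ Finset.Ico (M - j) (M - j + N), g (i + j) := by
        rw [Finset.sum_Ico_eq_sum_range, Nat.add_sub_cancel_left]
        refine Finset.sum_congr rfl fun n _ => ?_
        congr 1
        omega
    _ ≤ _ := by
        refine Finset.sum_le_sum_of_subset_of_nonneg (fun i hi => ?_) fun i _ _ => hg _
        rw [Finset.mem_Ico] at hi
        rw [Finset.mem_range]
        omega

/-- Large sieve inequality for damped exponentials with frequencies `δ`-separated modulo `1`,
with a free smoothing length `M`. -/
lemma mul_sum_norm_sq_le_of_separated {ι : Type*} [Fintype ι] (M N : ℕ) (t d : ι → ℝ) (z : ι → ℂ)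
    (hz : ∀ k, z k = Real.exp (-(d k)) * Complex.exp (2 * Real.pi * Complex.I * t k))
    (hd : ∀ k, 0 ≤ d k) (D : ℝ) (hD : ∀ k, d k ≤ D) (δ : ℝ) (hδ : 0 < δ)
    (hsep : ∀ (n : ℤ) (k l : ι), k ≠ l → δ ≤ |t k - t l + n|) (u : ι → ℂ) :
    M * ∑ n ∈ Finset.range N, ‖∑ k, u k * z k ^ n‖ ^ 2 ≤
      (M * (N + M * Real.exp (2 * D * M)) + Real.exp (2 * D * M) * (4 / δ ^ 2)) *
        ∑ k, ‖u k‖ ^ 2 := by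
  classical
  set E := Real.exp (2 * D * M) with hE
  have hnorm : ∀ k, ‖z k‖ = Real.exp (-(d k)) := by
    intro k
    rw [hz, norm_mul, Complex.norm_real, Real.norm_of_nonneg (Real.exp_pos _).le,
      show 2 * (Real.pi : ℂ) * Complex.I * t k = ((2 * Real.pi * t k : ℝ) : ℂ) * Complex.I by
        push_cast; ring, Complex.norm_exp_ofReal_mul_I, mul_one]
  have hpos : ∀ k, 0 < ‖z k‖ := fun k => by rw [hnorm]; exact Real.exp_pos _
  have hle : ∀ k, ‖z k‖ ≤ 1 := fun k => by
    rw [hnorm]; exact Real.exp_le_one_iff.2 (by linarith [hd k])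
  have hinv : ∀ k, (‖z k‖ ^ M)⁻¹ ≤ Real.exp (D * M) := by
    intro k
    rw [hnorm, ← Real.exp_nat_mul, ← Real.exp_neg, Real.exp_le_exp]
    nlinarith [hD k, (Nat.cast_nonneg M : (0 : ℝ) ≤ M)]
  have hEE : Real.exp (D * M) * Real.exp (D * M) = E := by
    rw [← Real.exp_add, hE]; congr 1; ring
  have hinv2 : ∀ k l, (‖z k‖ ^ M)⁻¹ * (‖z l‖ ^ M)⁻¹ ≤ E := fun k l => by
    rw [← hEE]
    exact mul_le_mul (hinv k) (hinv l) (inv_nonneg.2 (pow_nonneg (norm_nonneg _) _))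
      (Real.exp_pos _).le
  set w : ι → ι → ℂ := fun k l => z k * (starRingEnd ℂ) (z l) with hw
  have hwnorm : ∀ k l, ‖w k l‖ = ‖z k‖ * ‖z l‖ := fun k l => by
    rw [hw, norm_mul, RCLike.norm_conj]
  set G : ℕ → ι → ι → ℝ := fun L k l => ‖∑ n ∈ Finset.range L, w k l ^ n‖ with hG
  have hGsymm : ∀ L k l, G L k l = G L l k := by
    intro L k l
    have : w k l = (starRingEnd ℂ) (w l k) := by simp [hw, mul_comm]
    simp only [hG, this, ← map_pow, ← map_sum, RCLike.norm_conj]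
  have hGle : ∀ L k l, G L k l ≤ ∑ n ∈ Finset.range L, ‖w k l‖ ^ n := fun L k l =>
    (norm_sum_le _ _).trans_eq (by simp_rw [norm_pow])
  set b : ι → ι → ℝ := fun k l =>
    (‖z k‖ ^ M)⁻¹ * (‖z l‖ ^ M)⁻¹ * (G M k l * G (M + N) k l) with hb
  have hb0 : ∀ k l, 0 ≤ b k l := fun k l => by simp only [hb, hG]; positivity
  have hbsymm : ∀ k l, b k l = b l k := fun k l => by
    simp only [hb]
    rw [hGsymm M, hGsymm (M + N), mul_comm (‖z k‖ ^ M)⁻¹]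
  have hdiag : ∀ k, b k k ≤ M * (N + M * E) := by
    intro k
    have hq0 : 0 < ‖w k k‖ := by rw [hwnorm]; exact mul_pos (hpos k) (hpos k)
    have hq1 : ‖w k k‖ ≤ 1 := by
      rw [hwnorm]; exact mul_le_one₀ (hle k) (norm_nonneg _) (hle k)
    have hqM : (‖z k‖ ^ M)⁻¹ * (‖z k‖ ^ M)⁻¹ = (‖w k k‖ ^ M)⁻¹ := by
      rw [hwnorm, mul_pow, mul_inv]
    have hGM : G M k k ≤ M := (hGle M k k).trans <| by
      simpa using Finset.sum_le_card_nsmul (Finset.range M) (fun n => ‖w k k‖ ^ n) 1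
        fun n _ => pow_le_one₀ hq0.le hq1
    have hGN := (mul_le_mul_of_nonneg_left (hGle (M + N) k k)
      (inv_nonneg.2 (pow_nonneg hq0.le M))).trans (inv_pow_mul_geom_sum_le hq0 hq1 M N)
    calc b k k = G M k k * ((‖w k k‖ ^ M)⁻¹ * G (M + N) k k) := by
          simp only [hb]; rw [hqM]; ring
      _ ≤ M * (N + M * (‖w k k‖ ^ M)⁻¹) :=
          mul_le_mul hGM hGN (by simp only [hG]; positivity) (Nat.cast_nonneg _)
      _ ≤ M * (N + M * E) := by
          have := hinv2 k k
          rw [hqM] at this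
          gcongr
  set x : ι → ι → ℝ := fun k l => t k - t l - round (t k - t l) with hx
  have hxδ : ∀ k l, k ≠ l → δ ≤ |x k l| := fun k l hkl => by
    have := hsep (-round (t k - t l)) k l hkl
    push_cast at this
    rwa [← sub_eq_add_neg] at this
  have hwx : ∀ k l, 2 * |x k l| ≤ ‖1 - w k l‖ := by
    intro k l
    have h := two_mul_abs_sub_round_le_norm_one_sub (Real.exp (-(d k) - d l)) (t k - t l)
      (Real.exp_pos _).le (Real.exp_le_one_iff.2 (by linarith [hd k, hd l]))
    have hwe : w k l = (Real.exp (-(d k) - d l) : ℂ) *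
        Complex.exp (2 * Real.pi * Complex.I * ((t k - t l : ℝ) : ℂ)) := by
      simp only [hw, hz, Complex.ofReal_exp, ← Complex.exp_conj, ← Complex.exp_add, map_add,
        map_mul, map_ofNat, Complex.conj_ofReal, Complex.conj_I]
      congr 1
      push_cast
      ring
    rwa [hwe]
  have hoff : ∀ k l, k ≠ l → b k l ≤ E * (1 / δ ^ 2 * (1 / (x k l / δ) ^ 2)) := by
    intro k l hkl
    have hx0 : 0 < |x k l| := hδ.trans_le (hxδ k l hkl)
    have hw1 : ‖w k l‖ ≤ 1 := by
      rw [hwnorm]; exact mul_le_one₀ (hle k) (norm_nonneg _) (hle l)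
    have hGx : ∀ L, G L k l ≤ 1 / |x k l| := by
      intro L
      rw [le_div_iff₀ hx0]
      have h1 := norm_geom_sum_mul_norm_one_sub_le hw1 L
      have h2 := mul_le_mul_of_nonneg_left (hwx k l)
        (norm_nonneg (∑ n ∈ Finset.range L, w k l ^ n))
      simp only [hG]
      linarith
    calc b k l ≤ E * (1 / |x k l| * (1 / |x k l|)) := by
          refine mul_le_mul (hinv2 k l) ?_ (by simp only [hG]; positivity) (Real.exp_pos _).le
          exact mul_le_mul (hGx _) (hGx _) (norm_nonneg _) (by positivity)
      _ = E * (1 / δ ^ 2 * (1 / (x k l / δ) ^ 2)) := by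
          rw [div_mul_div_comm, ← sq |x k l|, sq_abs]
          have := abs_pos.1 hx0
          field_simp
  have hrow : ∀ k, ∑ l, b k l ≤ M * (N + M * E) + E * (4 / δ ^ 2) := by
    intro k
    rw [← Finset.add_sum_erase _ _ (Finset.mem_univ k)]
    refine add_le_add (hdiag k) ?_
    have hfour := sum_inv_sq_le_four_of_one_le_abs (Finset.univ.erase k) (fun l => x k l / δ)
      (fun l hl => by
        rw [abs_div, abs_of_pos hδ, one_le_div hδ]
        exact hxδ k l (Finset.ne_of_mem_erase hl).symm)
      (fun l _ m _ hlm => by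
        rw [← sub_div, abs_div, abs_of_pos hδ, one_le_div hδ]
        refine (hsep (round (t k - t m) - round (t k - t l)) m l hlm.symm).trans_eq ?_
        congr 1
        simp only [hx]
        push_cast
        ring)
    calc ∑ l ∈ Finset.univ.erase k, b k l
        ≤ ∑ l ∈ Finset.univ.erase k, E * (1 / δ ^ 2 * (1 / (x k l / δ) ^ 2)) :=
          Finset.sum_le_sum fun l hl => hoff k l (Finset.ne_of_mem_erase hl).symm
      _ = E * (1 / δ ^ 2 * ∑ l ∈ Finset.univ.erase k, 1 / (x k l / δ) ^ 2) := by
          rw [Finset.mul_sum, Finset.mul_sum]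
      _ ≤ E * (1 / δ ^ 2 * 4) := by gcongr
      _ = E * (4 / δ ^ 2) := by ring
  set v : ι → ℂ := fun k => u k * (z k ^ M)⁻¹ with hv
  have hshift : ∀ n, ∑ k, u k * z k ^ n = ∑ k, v k * z k ^ (M + n) := by
    intro n
    refine Finset.sum_congr rfl fun k _ => ?_
    have : z k ^ M ≠ 0 := pow_ne_zero _ (norm_pos_iff.1 (hpos k))
    simp only [hv]
    rw [pow_add]
    field_simp
  simp_rw [hshift]
  refine (mul_sum_range_le_sum_window (fun n => ‖∑ k, v k * z k ^ n‖ ^ 2)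
    (fun _ => sq_nonneg _) M N).trans ?_
  refine (le_abs_self _).trans ?_
  rw [← Real.norm_eq_abs, ← Complex.norm_real, sum_norm_sq_add_index_eq]
  refine le_trans ?_ (sum_mul_mul_le_of_row_sum_le (fun k => ‖u k‖) b hb0 hbsymm _ hrow)
  refine (norm_sum_le _ _).trans (Finset.sum_le_sum fun k _ => ?_)
  refine (norm_sum_le _ _).trans (Finset.sum_le_sum fun l _ => le_of_eq ?_)
  simp only [hv, hb, hG, hw, norm_mul, RCLike.norm_conj, norm_inv, norm_pow]
  ring

lemma enorm2_sq {n : ℕ} (v : Fin n → ℂ) : enorm2 v ^ 2 = ∑ i, ‖v i‖ ^ 2 :=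
  Real.sq_sqrt (Finset.sum_nonneg fun _ _ => sq_nonneg _)

lemma enorm2_vand_mulVec_sq {K : ℕ} (z : Fin K → ℂ) (N : ℕ) (u : Fin K → ℂ) :
    enorm2 ((vand z N).mulVec u) ^ 2 = ∑ n ∈ Finset.range N, ‖∑ k, u k * z k ^ n‖ ^ 2 := by
  rw [enorm2_sq, ← Fin.sum_univ_eq_sum_range fun n => ‖∑ k, u k * z k ^ n‖ ^ 2]
  simp only [Matrix.mulVec, dotProduct, vand, Matrix.of_apply, mul_comm]

/-- Upper bound on the squared largest singular value of the Vandermonde matrix with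
nodes `z k = exp (-(d k)) * exp (2 π i (f k) / Fs)` inside the unit disk, stated in the
equivalent vector form: `‖V_N u‖₂² ≤ [N − 1 + 84 F_s/(π δ)] ‖u‖₂²`. -/
theorem vandermonde_sigma_max_upper_bound
    (K N : ℕ) (hK : 2 ≤ K) (hN : 2 ≤ N)
    (Fs : ℝ) (hFs : 0 < Fs)
    (d f : Fin K → ℝ) (hd : ∀ k, 0 ≤ d k)
    (hf : ∀ k, 0 ≤ f k ∧ f k < Fs) (hfinj : Function.Injective f)
    (z : Fin K → ℂ)
    (hz : ∀ k, z k = Real.exp (-(d k)) * Complex.exp (2 * Real.pi * Complex.I * (f k) / Fs))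
    (dmax : ℝ) (hdmax : IsGreatest (Set.range d) dmax)
    (δ : ℝ)
    (hδ : IsLeast {x : ℝ | ∃ (n : ℤ) (k l : Fin K), k ≠ l ∧ x = |f k - f l + n * Fs|} δ)
    (hdmax_small : dmax < 1 / ((N : ℝ) - 1))
    (hδ_large : 84 * Fs / (Real.pi * ((N : ℝ) - 1) * (1 - dmax * ((N : ℝ) - 1))) < δ) :
    ∀ u : Fin K → ℂ,
      enorm2 ((vand z N).mulVec u) ^ 2
        ≤ ((N : ℝ) - 1 + 84 * Fs / (Real.pi * δ)) * enorm2 u ^ 2 := by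
  intro u
  have hN1 : (0 : ℝ) < (N : ℝ) - 1 := by
    have : (2 : ℝ) ≤ N := by exact_mod_cast hN
    linarith
  obtain ⟨⟨k₀, hk₀⟩, hub⟩ := hdmax
  have hdle : ∀ k, d k ≤ dmax := fun k => hub ⟨k, rfl⟩
  have hdmax0 : 0 ≤ dmax := hk₀ ▸ hd k₀
  have hdN : dmax * ((N : ℝ) - 1) < 1 := (lt_div_iff₀ hN1).1 hdmax_small
  have hpi := Real.pi_pos
  have hprod : 0 < Real.pi * ((N : ℝ) - 1) * (1 - dmax * ((N : ℝ) - 1)) :=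
    mul_pos (mul_pos hpi hN1) (by linarith)
  have hδ0 : 0 < δ := lt_trans (by positivity) hδ_large
  set η := δ / Fs with hη
  have hη0 : 0 < η := div_pos hδ0 hFs
  have hsep : ∀ (n : ℤ) (k l : Fin K), k ≠ l → η ≤ |f k / Fs - f l / Fs + n| := by
    intro n k l hkl
    rw [hη, div_le_iff₀ hFs]
    refine (hδ.2 ⟨n, k, l, hkl, rfl⟩).trans_eq ?_
    rw [← abs_of_pos hFs, ← abs_mul, abs_of_pos hFs]
    congr 1
    field_simp
  have hη_half : η ≤ 1 / 2 := by
    let k : Fin K := ⟨0, by omega⟩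
    let l : Fin K := ⟨1, by omega⟩
    have h := hsep (-round (f k / Fs - f l / Fs)) k l (by simp [k, l])
    push_cast at h
    rw [← sub_eq_add_neg] at h
    exact h.trans (abs_sub_round _)
  have hdη : 84 * dmax ≤ Real.pi * η := by
    rw [div_lt_iff₀ hprod] at hδ_large
    have h1 : 84 < Real.pi * η * ((N : ℝ) - 1) * (1 - dmax * ((N : ℝ) - 1)) := by
      rw [hη]
      have : 84 * Fs / Fs < δ * (Real.pi * ((N : ℝ) - 1) * (1 - dmax * ((N : ℝ) - 1))) / Fs :=
        div_lt_div_of_pos_right hδ_large hFs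
      rw [mul_div_cancel_right₀ _ hFs.ne'] at this
      refine this.trans_eq ?_
      ring
    have h2 : 84 < Real.pi * η * ((N : ℝ) - 1) := by
      refine h1.trans_le (mul_le_of_le_one_right (by positivity) ?_)
      nlinarith
    have h3 : 84 * dmax * ((N : ℝ) - 1) ≤ Real.pi * η * ((N : ℝ) - 1) := by linarith
    exact le_of_mul_le_mul_right h3 hN1
  set M := ⌈1 / η⌉₊ with hM
  have hM1 : 1 ≤ M * η := by
    rw [← div_le_iff₀ hη0]
    exact Nat.le_ceil _
  have hM2 : M * η ≤ 3 / 2 := by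
    have h := (Nat.ceil_lt_add_one (by positivity : 0 ≤ 1 / η)).le
    have h' := mul_le_mul_of_nonneg_right h hη0.le
    rw [add_mul, div_mul_cancel₀ _ hη0.ne'] at h'
    linarith
  have hM0 : (0 : ℝ) < M := pos_of_mul_pos_left (by linarith) hη0.le
  have hE : Real.exp (2 * dmax * M) ≤ 2 := by
    have hx : 2 * dmax * M ≤ 1 / 2 := by
      have h1 : 84 * (dmax * M) ≤ Real.pi * (M * η) := by nlinarith
      have h2 : Real.pi * (M * η) ≤ 4 * (3 / 2) :=
        mul_le_mul Real.pi_le_four hM2 (by positivity) (by norm_num)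
      linarith
    refine (Real.exp_bound_div_one_sub_of_interval (by positivity) (by linarith)).trans ?_
    rw [div_le_iff₀ (by linarith)]
    linarith
  have hmain := mul_sum_norm_sq_le_of_separated M N (fun k => f k / Fs) d z
    (fun k => by rw [hz]; push_cast; congr 2; ring) hd dmax hdle η hη0 hsep u
  rw [enorm2_vand_mulVec_sq, enorm2_sq]
  refine le_of_mul_le_mul_left (hmain.trans ?_) hM0
  rw [← mul_assoc]
  refine mul_le_mul_of_nonneg_right ?_ (Finset.sum_nonneg fun _ _ => sq_nonneg _)
  have h84 : 26 / η ≤ 84 * Fs / (Real.pi * δ) := by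
    have : 84 * Fs / (Real.pi * δ) = 84 / Real.pi / η := by
      rw [hη]
      field_simp
    rw [this]
    gcongr
    rw [le_div_iff₀ hpi]
    linarith [Real.pi_lt_d2]
  have hinvM : 1 / η ≤ M := Nat.le_ceil _
  have hMη : (M : ℝ) ≤ 3 / 2 / η := (le_div_iff₀ hη0).2 hM2
  have hsq : 4 / η ^ 2 ≤ M * (4 / η) := by
    calc 4 / η ^ 2 = 1 / η * (4 / η) := by field_simp
      _ ≤ _ := by gcongr
  have h1η : 1 ≤ 1 / η := by rw [le_div_iff₀ hη0]; linarith
  calc M * (N + M * Real.exp (2 * dmax * M)) + Real.exp (2 * dmax * M) * (4 / η ^ 2)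
      ≤ M * (N + 3 / 2 / η * 2) + 2 * (M * (4 / η)) := by gcongr
    _ = M * ((N : ℝ) + 11 * (1 / η)) := by ring
    _ ≤ M * ((N : ℝ) - 1 + 84 * Fs / (Real.pi * δ)) := by
      refine mul_le_mul_of_nonneg_left ?_ hM0.le
      rw [show 26 / η = 26 * (1 / η) by ring] at h84
      linarith
end

section
/- Let K ≥ 1, N ≥ 2K, K ≤ L ≤ N−K, nodes z_1,…,z_K ∈ ℂ nonzero and pairwise distinct, weights α_1,…,α_K ∈ ℂ all nonzero, and x_n = Σ_{k=1}^K α_k z_k^n. Set X₁ = H_L(x_0,…,x_{N−2}) and X₂ = H_L(x_1,…,x_{N−1}). Then for every λ ∈ ℂ, the rank of the matrix pencil X₂ − λ X₁ equals the number of indices k ∈ {1,…,K} with z_k ≠ λ. In particular, rank(X₂ − λX₁) = K − 1 if λ ∈ {z_1,…,z_K} and rank(X₂ − λX₁) = K otherwise: the rank of the pencil drops by exactly one precisely at the nodes. -/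
open scoped BigOperators

/-- Hankel matrix with `L` rows and `M` columns built from the sequence `x`:
entry `(i, j)` is `x (i + j)`. -/
def hankel (L M : ℕ) (x : ℕ → ℂ) : Matrix (Fin L) (Fin M) ℂ :=
  Matrix.of fun i j => x ((i : ℕ) + (j : ℕ))

/-- A Hankel matrix of an exponential sum factors through the matrices of node powers. -/
theorem hankel_exponential_sum {K : ℕ} (L M : ℕ) (z c : Fin K → ℂ) :
    hankel L M (fun n => ∑ k, c k * z k ^ n) =
      (Matrix.of fun (i : Fin L) k => z k ^ (i : ℕ)) * Matrix.diagonal c *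
        (Matrix.of fun k (j : Fin M) => z k ^ (j : ℕ)) := by
  ext i j
  rw [Matrix.mul_apply]
  simp only [hankel, Matrix.of_apply, Matrix.mul_diagonal]
  exact Finset.sum_congr rfl fun k _ => by ring

open scoped Classical in
/-- For distinct nodes and sufficiently large size, the rank of the Hankel matrix of an exponential
sum is the number of nonzero weights. -/
theorem rank_hankel_exponential_sum {K L M : ℕ} (hL : K ≤ L) (hM : K ≤ M) {z : Fin K → ℂ}
    (hz : Function.Injective z) (c : Fin K → ℂ) :
    (hankel L M (fun n => ∑ k, c k * z k ^ n)).rank =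
      (Finset.univ.filter fun k => c k ≠ 0).card := by
  have hdiag : (Matrix.diagonal c).rank = (Finset.univ.filter fun k => c k ≠ 0).card := by
    rw [Matrix.rank_diagonal, Fintype.card_subtype]
  rw [← hdiag]
  apply le_antisymm
  · rw [hankel_exponential_sum]
    exact (Matrix.rank_mul_le_left _ _).trans (Matrix.rank_mul_le_right _ _)
  · have hdet : (Matrix.vandermonde z).det ≠ 0 := Matrix.det_vandermonde_ne_zero_iff.mpr hz
    have hsub : (hankel L M (fun n => ∑ k, c k * z k ^ n)).submatrix
        (Fin.castLE hL) (Fin.castLE hM) =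
        (Matrix.vandermonde z).transpose * Matrix.diagonal c * Matrix.vandermonde z :=
      hankel_exponential_sum K K z c
    calc (Matrix.diagonal c).rank
        = ((Matrix.vandermonde z).transpose * Matrix.diagonal c * Matrix.vandermonde z).rank := by
          rw [Matrix.rank_mul_eq_left_of_det_ne_zero _ _ hdet,
            Matrix.rank_mul_eq_right_of_det_ne_zero _ _ (by rwa [Matrix.det_transpose])]
      _ ≤ _ := by
          rw [← hsub]
          exact Matrix.rank_submatrix_le _ _ _

/-- The Hankel pencil of an exponential sum is the Hankel matrix of the exponential sum with
weights `α k * (z k - lam)`. -/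
theorem hankel_pencil_exponential_sum {K : ℕ} (L M : ℕ) (z α : Fin K → ℂ) (lam : ℂ) :
    hankel L M (fun n => ∑ k, α k * z k ^ (n + 1))
        - lam • hankel L M (fun n => ∑ k, α k * z k ^ n) =
      hankel L M (fun n => ∑ k, α k * (z k - lam) * z k ^ n) := by
  ext i j
  simp only [hankel, Matrix.sub_apply, Matrix.smul_apply, Matrix.of_apply, smul_eq_mul,
    Finset.mul_sum, ← Finset.sum_sub_distrib]
  exact Finset.sum_congr rfl fun k _ => by ring

open scoped Classical in
/-- Rank of the matrix pencil `X₂ − λ X₁` built from the Hankel matrices of the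
signal `x n = ∑ k, α k * z k ^ n`: for every `λ ∈ ℂ` the rank equals the number of
nodes different from `λ`; in particular it drops by exactly one precisely at the
nodes. -/
theorem matrix_pencil_rank
    (K N L : ℕ) (hK : 1 ≤ K) (hN : 2 * K ≤ N) (hKL : K ≤ L) (hLN : L ≤ N - K)
    (z α : Fin K → ℂ)
    (hz0 : ∀ k, z k ≠ 0) (hzinj : Function.Injective z)
    (hα : ∀ k, α k ≠ 0) :
    ∀ lam : ℂ,
      (hankel L (N - L) (fun n => ∑ k, α k * z k ^ (n + 1))
          - lam • hankel L (N - L) (fun n => ∑ k, α k * z k ^ n)).rank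
        = (Finset.univ.filter fun k => z k ≠ lam).card
      ∧ (lam ∈ Set.range z →
          (hankel L (N - L) (fun n => ∑ k, α k * z k ^ (n + 1))
              - lam • hankel L (N - L) (fun n => ∑ k, α k * z k ^ n)).rank = K - 1)
      ∧ (lam ∉ Set.range z →
          (hankel L (N - L) (fun n => ∑ k, α k * z k ^ (n + 1))
              - lam • hankel L (N - L) (fun n => ∑ k, α k * z k ^ n)).rank = K) := by
  intro lam
  have hrank : (hankel L (N - L) (fun n => ∑ k, α k * z k ^ (n + 1))
      - lam • hankel L (N - L) (fun n => ∑ k, α k * z k ^ n)).rank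
        = (Finset.univ.filter fun k => z k ≠ lam).card := by
    rw [hankel_pencil_exponential_sum, rank_hankel_exponential_sum hKL (by omega) hzinj]
    simp [hα, sub_eq_zero]
  refine ⟨hrank, ?_, ?_⟩
  · rintro ⟨k₀, rfl⟩
    rw [hrank]
    simp [hzinj.ne_iff, Finset.filter_ne']
  · intro hlam
    rw [hrank, Finset.filter_true_of_mem (p := fun k => z k ≠ lam) fun k _ hk => hlam ⟨k, hk⟩,
      Finset.card_fin]
end
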